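/- Let n ≥ 1 be an integer and let α satisfy 0 < α < 1. Let u_0,…,u_n be the Clopper–Pearson upper endpoints at level 1−α (u_n = 1 and Σ_{x=0}^{i} B(n,x,u_i) = α for i = 0,…,n−1). Let v_0,…,v_n be any sequence with 0 < v_0 ≤ v_1 ≤ ⋯ ≤ v_n = 1 whose coverage C_v(p) = Σ_{x=i}^n B(n,x,p) (for the smallest index i with p ≤ v_i) satisfies C_v(p) ≥ 1−α for every p ∈ (0,1]. Then u_i ≤ v_i for every i = 0,…,n; hence the Clopper–Pearson method has the smallest average expected length among all upper-tail interval estimators whose coverage is at least 1−α at every p. -/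

import Mathlib

open MeasureTheory

/-- The binomial probability mass function: `B n x p = C(n,x) p^x (1-p)^(n-x)`. -/
noncomputable def B (n x : ℕ) (p : ℝ) : ℝ :=
  (n.choose x : ℝ) * p ^ x * (1 - p) ^ (n - x)

/-- A sequence `0 < u 0 < u 1 < ⋯ < u n = 1` of OLC upper endpoints at level `1 - α`:
each inter-spike average coverage equals the nominal level. -/
def IsOLCUpper (n : ℕ) (α : ℝ) (u : ℕ → ℝ) : Prop :=
  0 < u 0 ∧ (∀ i, i < n → u i < u (i + 1)) ∧ u n = 1 ∧
    ∀ i, 1 ≤ i → i ≤ n →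
      (∫ p in (u (i - 1))..(u i), ∑ x ∈ Finset.Icc i n, B n x p)
        = (1 - α) * (u i - u (i - 1))

/-- A sequence `0 < v 0 < v 1 < ⋯ < v n = 1` giving upper-tail locally correct confidence
(LCC) intervals at level `1 - α`: each inter-spike average coverage is at least the
nominal level. -/
def IsLCCUpper (n : ℕ) (α : ℝ) (v : ℕ → ℝ) : Prop :=
  0 < v 0 ∧ (∀ i, i < n → v i < v (i + 1)) ∧ v n = 1 ∧
    ∀ i, 1 ≤ i → i ≤ n →
      (1 - α) * (v i - v (i - 1))
        ≤ ∫ p in (v (i - 1))..(v i), ∑ x ∈ Finset.Icc i n, B n x p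

/-- A sequence `0 = l 0 < l 1 < ⋯ < l n < 1` of OLC lower endpoints at level `1 - α`. -/
def IsOLCLower (n : ℕ) (α : ℝ) (l : ℕ → ℝ) : Prop :=
  l 0 = 0 ∧ (∀ i, i < n → l i < l (i + 1)) ∧ l n < 1 ∧
    ∀ i, i < n →
      (∫ p in (l i)..(l (i + 1)), ∑ x ∈ Finset.range (i + 1), B n x p)
        = (1 - α) * (l (i + 1) - l i)

/-- A sequence `0 = l 0 < l 1 < ⋯ < l n < 1` giving lower-tail LCC intervals at level
`1 - α`. -/
def IsLCCLower (n : ℕ) (α : ℝ) (l : ℕ → ℝ) : Prop :=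
  l 0 = 0 ∧ (∀ i, i < n → l i < l (i + 1)) ∧ l n < 1 ∧
    ∀ i, i < n →
      (1 - α) * (l (i + 1) - l i)
        ≤ ∫ p in (l i)..(l (i + 1)), ∑ x ∈ Finset.range (i + 1), B n x p

/-- The coverage of an upper-tail endpoint sequence `w` at `p`:
`∑_{x=i}^n B(n,x,p)` where `i` is the smallest index with `p ≤ w i`. -/
noncomputable def cov (n : ℕ) (w : ℕ → ℝ) (p : ℝ) : ℝ :=
  ∑ x ∈ Finset.Icc (sInf {i : ℕ | p ≤ w i}) n, B n x p

/-- Clopper–Pearson upper endpoints at level `1 - α`: `u n = 1` and, for `i < n`,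
`u i ∈ (0,1)` solves `P(X ≤ i) = α` at `p = u i`. -/
def IsCPUpper (n : ℕ) (α : ℝ) (u : ℕ → ℝ) : Prop :=
  u n = 1 ∧ ∀ i, i < n → 0 < u i ∧ u i < 1 ∧
    ∑ x ∈ Finset.range (i + 1), B n x (u i) = α

theorem B_nonneg (n x : ℕ) {p : ℝ} (hp0 : 0 ≤ p) (hp1 : p ≤ 1) : 0 ≤ B n x p := by
  have : 0 ≤ 1 - p := sub_nonneg.2 hp1
  unfold B
  positivity

theorem continuous_B (n x : ℕ) : Continuous (B n x) := by
  unfold B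
  fun_prop

theorem sum_range_B (n : ℕ) (p : ℝ) : ∑ x ∈ Finset.range (n + 1), B n x p = 1 := by
  have h := add_pow p (1 - p) n
  rw [add_sub_cancel, one_pow] at h
  rw [h]
  exact Finset.sum_congr rfl fun x _ => by unfold B; ring

theorem sum_range_add_sum_Icc_B {n i : ℕ} (hi : i < n) (p : ℝ) :
    ∑ x ∈ Finset.range (i + 1), B n x p + ∑ x ∈ Finset.Icc (i + 1) n, B n x p = 1 := by
  rw [← sum_range_B n p, ← Finset.Ico_add_one_right_eq_Icc,
    Finset.sum_range_add_sum_Ico _ (by omega)]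

theorem hasDerivAt_B_zero (n : ℕ) (p : ℝ) :
    HasDerivAt (B n 0) (-(n * (1 - p) ^ (n - 1))) p := by
  have h := ((hasDerivAt_id p).const_sub 1).pow n
  have hB : B n 0 = (fun q : ℝ => 1 - id q) ^ n := by
    ext q
    simp [B]
  rw [hB]
  exact h.congr_deriv (by simp)

theorem hasDerivAt_B_succ (n i : ℕ) (p : ℝ) :
    HasDerivAt (B n (i + 1))
      ((n - i : ℕ) * n.choose i * p ^ i * (1 - p) ^ (n - i - 1)
        - (n - (i + 1) : ℕ) * n.choose (i + 1) * p ^ (i + 1) * (1 - p) ^ (n - (i + 1) - 1)) p := by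
  have h := (((hasDerivAt_id p).pow (i + 1)).const_mul (n.choose (i + 1) : ℝ)).mul
    (((hasDerivAt_id p).const_sub 1).pow (n - (i + 1)))
  have hc : (n.choose (i + 1) : ℝ) * ((i : ℝ) + 1) = n.choose i * (n - i : ℕ) := by
    exact_mod_cast Nat.choose_succ_right_eq n i
  refine h.congr_deriv ?_
  have he : n - i - 1 = n - (i + 1) := by omega
  simp only [id, Pi.pow_apply, he, Nat.cast_add, Nat.cast_one, Nat.add_sub_cancel]
  linear_combination (p ^ i * (1 - p) ^ (n - (i + 1))) * hc

theorem hasDerivAt_sum_range_B (n i : ℕ) (p : ℝ) :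
    HasDerivAt (fun q => ∑ x ∈ Finset.range (i + 1), B n x q)
      (-((n - i : ℕ) * n.choose i * p ^ i * (1 - p) ^ (n - i - 1))) p := by
  induction i with
  | zero => simpa using hasDerivAt_B_zero n p
  | succ i ih =>
    simp only [Finset.sum_range_succ _ (i + 1)]
    exact (ih.add (hasDerivAt_B_succ n i p)).congr_deriv (by ring)

theorem strictAntiOn_sum_range_B {n i : ℕ} (hi : i < n) :
    StrictAntiOn (fun p => ∑ x ∈ Finset.range (i + 1), B n x p) (Set.Icc 0 1) := by
  refine strictAntiOn_of_deriv_neg (convex_Icc 0 1)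
    (continuous_finsetSum _ fun x _ => continuous_B n x).continuousOn fun p hp => ?_
  rw [interior_Icc] at hp
  rw [(hasDerivAt_sum_range_B n i p).deriv, neg_lt_zero]
  have h0 : 0 < p := hp.1
  have h1 : 0 < 1 - p := sub_pos.2 hp.2
  have h2 : (0 : ℝ) < (n - i : ℕ) := Nat.cast_pos.2 (Nat.sub_pos_of_lt hi)
  have h3 : (0 : ℝ) < n.choose i := Nat.cast_pos.2 (Nat.choose_pos hi.le)
  positivity

theorem le_of_le_succ_of_le {n : ℕ} {v : ℕ → ℝ} (hv : ∀ i, i < n → v i ≤ v (i + 1))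
    {i j : ℕ} (hij : i ≤ j) (hj : j ≤ n) : v i ≤ v j := by
  induction j, hij using Nat.le_induction with
  | base => exact le_rfl
  | succ j _ ih => exact (ih (by omega)).trans (hv j (by omega))

/-- Past the endpoint `v i`, the coverage is at most the upper tail `P(X > i)`. -/
theorem cov_le_sum_Icc {n : ℕ} {v : ℕ → ℝ} (hv : ∀ i, i < n → v i ≤ v (i + 1))
    (hvn : v n = 1) {i : ℕ} (hi : i < n) {p : ℝ} (hp0 : 0 ≤ p) (hp1 : p ≤ 1) (hip : v i < p) :
    cov n v p ≤ ∑ x ∈ Finset.Icc (i + 1) n, B n x p := by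
  have hmem : p ≤ v (sInf {j : ℕ | p ≤ v j}) := Nat.sInf_mem (s := {j : ℕ | p ≤ v j}) ⟨n, hp1.trans_eq hvn.symm⟩
  have hlt : i + 1 ≤ sInf {j : ℕ | p ≤ v j} := by
    by_contra! hle
    exact absurd (hmem.trans (le_of_le_succ_of_le hv (by omega) hi.le)) hip.not_ge
  exact Finset.sum_le_sum_of_subset_of_nonneg (Finset.Icc_subset_Icc_left hlt)
    fun x _ _ => B_nonneg n x hp0 hp1

theorem stmt_13 (n : ℕ) (hn : 1 ≤ n)
    (α : ℝ) (hα1 : 0 < α) (hα2 : α < 1)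
    (u : ℕ → ℝ) (hu : IsCPUpper n α u)
    (v : ℕ → ℝ) (hv0 : 0 < v 0) (hvmono : ∀ i, i < n → v i ≤ v (i + 1))
    (hvn : v n = 1)
    (hcov : ∀ p : ℝ, 0 < p → p ≤ 1 → 1 - α ≤ cov n v p) :
    (∀ i, i ≤ n → u i ≤ v i) ∧
      (∫ p in (0:ℝ)..1, ∑ x ∈ Finset.range (n + 1), u x * B n x p)
        ≤ ∫ p in (0:ℝ)..1, ∑ x ∈ Finset.range (n + 1), v x * B n x p := by
  have hle : ∀ i, i ≤ n → u i ≤ v i := by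
    intro i hi
    rcases hi.eq_or_lt with rfl | hi
    · rw [hu.1, hvn]
    by_contra! hlt
    obtain ⟨hu0, hu1, hsum⟩ := hu.2 i hi
    obtain ⟨p, hvp, hpu⟩ := exists_between hlt
    have hp0 : 0 < p := hv0.trans_le (le_of_le_succ_of_le hvmono i.zero_le hi.le) |>.trans hvp
    have hp1 : p < 1 := hpu.trans hu1
    have hanti := strictAntiOn_sum_range_B hi ⟨hp0.le, hp1.le⟩ ⟨hu0.le, hu1.le⟩ hpu
    have hc := hcov p hp0 hp1.le
    have hc' := cov_le_sum_Icc hvmono hvn hi hp0.le hp1.le hvp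
    have htotal := sum_range_add_sum_Icc_B hi p
    simp only [hsum] at hanti
    linarith
  have hint (w : ℕ → ℝ) : IntervalIntegrable
      (fun p => ∑ x ∈ Finset.range (n + 1), w x * B n x p) volume 0 1 :=
    (continuous_finsetSum _ fun x _ => (continuous_B n x).const_mul (w x)).intervalIntegrable _ _
  refine ⟨hle, intervalIntegral.integral_mono_on zero_le_one (hint u) (hint v) fun p hp => ?_⟩
  exact Finset.sum_le_sum fun x hx => mul_le_mul_of_nonneg_right
    (hle x (Nat.lt_succ_iff.1 (Finset.mem_range.1 hx))) (B_nonneg n x hp.1 hp.2)
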